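/- arXiv:1703.09460 — 2 statements merged into one kernel-verified Lean document; each statement's English description precedes it below -/
import Mathlib

section
/- Let 1 ≤ d ≤ 3, T > 0, 0 < ν < ε, γ > 1, s ≥ −1, and let (ρ, u) be smooth on [0,T] × 𝕋^d with ρ > 0 solving the Navier–Stokes–Korteweg system of capillarity ε and viscosity ν. Set v = ∇(μ∘ρ)/ρ, w = u + νv, v̄ = √(ε²−ν²) v, and E^{NF}(t) = ∫_{𝕋^d} ( ½ρ|v̄|² + ½ρ|w|² + H(ρ) ). Then for every t ∈ [0,T]: E^{NF}(t) + ν ∫_0^t ∫_{𝕋^d} μ'(ρ) H''(ρ) |∇ρ|² + ν ∫_0^t ∫_{𝕋^d} ( μ(ρ)(|∇w|² + |∇v̄|²) + (λ(ρ)/2)(|div v̄|² + |div w|²) ) = E^{NF}(0). -/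
open MeasureTheory

noncomputable section

abbrev Vec (d : ℕ) := Fin d → ℝ

/-- Spatial partial derivative in direction `i`. -/
noncomputable def pd {d : ℕ} (i : Fin d) (f : Vec d → ℝ) (x : Vec d) : ℝ :=
  fderiv ℝ f x (Pi.single i 1)

/-- Periodicity with period `1` in each space direction: this models fields on the torus
`𝕋^d = (ℝ/ℤ)^d`. -/
def SpacePeriodic {d : ℕ} {α : Type*} (f : ℝ → Vec d → α) : Prop :=
  ∀ (t : ℝ) (x : Vec d) (k : Fin d → ℤ), f t (fun i => x i + (k i : ℝ)) = f t x

/-- Fundamental domain `[0,1]^d` of the torus. -/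
def Box (d : ℕ) : Set (Vec d) := Set.Icc 0 1

/-- Partial derivative in the space direction `i` of a function of time and space. -/
def dx {d : ℕ} (i : Fin d) (f : ℝ × Vec d → ℝ) (p : ℝ × Vec d) : ℝ :=
  pd i (fun y => f (p.1, y)) p.2

/-- Time derivative of a function of time and space. -/
def dt {d : ℕ} (f : ℝ × Vec d → ℝ) (p : ℝ × Vec d) : ℝ :=
  deriv (fun τ => f (τ, p.2)) p.1

/-- Functions of time and space that are smooth on `Ω` and `1`-periodic in space. -/
structure PeriodicSmooth {d : ℕ} (Ω : Set (ℝ × Vec d)) (f : ℝ × Vec d → ℝ) : Prop where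
  contDiffOn : ContDiffOn ℝ (⊤ : ℕ∞) f Ω
  periodic : ∀ t x (k : Fin d → ℤ), f (t, fun i => x i + (k i : ℝ)) = f (t, x)

section Calculus

variable {d : ℕ} {Ω : Set (ℝ × Vec d)} {f g : ℝ × Vec d → ℝ} {p : ℝ × Vec d}

theorem dx_eq_fderiv (hf : DifferentiableAt ℝ f p) (i : Fin d) :
    dx i f p = fderiv ℝ f p (0, Pi.single i 1) := by
  have h : HasFDerivAt (fun y => f (p.1, y))
      ((fderiv ℝ f p).comp (ContinuousLinearMap.inr ℝ ℝ (Vec d))) p.2 :=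
    HasFDerivAt.comp p.2 (g := f) hf.hasFDerivAt (hasFDerivAt_prodMk_right p.1 p.2)
  simp [dx, pd, h.fderiv]

theorem hasDerivAt_time (hf : DifferentiableAt ℝ f p) :
    HasDerivAt (fun τ => f (τ, p.2)) (fderiv ℝ f p (1, 0)) p.1 := by
  have h : HasFDerivAt (fun y => f (y, p.2))
      ((fderiv ℝ f p).comp (ContinuousLinearMap.inl ℝ ℝ (Vec d))) p.1 :=
    HasFDerivAt.comp p.1 (g := f) hf.hasFDerivAt (hasFDerivAt_prodMk_left p.1 p.2)
  simpa using h.hasDerivAt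

theorem dt_eq_fderiv (hf : DifferentiableAt ℝ f p) : dt f p = fderiv ℝ f p (1, 0) :=
  (hasDerivAt_time hf).deriv

theorem dx_congr (h : ∀ y, f (p.1, y) = g (p.1, y)) (i : Fin d) : dx i f p = dx i g p := by
  simp only [dx, h]

namespace PeriodicSmooth

theorem contDiffAt (hf : PeriodicSmooth Ω f) (hΩ : IsOpen Ω) (hp : p ∈ Ω) :
    ContDiffAt ℝ (⊤ : ℕ∞) f p :=
  hf.contDiffOn.contDiffAt (hΩ.mem_nhds hp)

theorem differentiableAt (hf : PeriodicSmooth Ω f) (hΩ : IsOpen Ω) (hp : p ∈ Ω) :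
    DifferentiableAt ℝ f p :=
  (hf.contDiffAt hΩ hp).differentiableAt (by simp)

theorem differentiableAt_space (hf : PeriodicSmooth Ω f) (hΩ : IsOpen Ω) (hp : p ∈ Ω) :
    DifferentiableAt ℝ (fun y => f (p.1, y)) p.2 :=
  DifferentiableAt.comp p.2 (g := f) (hf.differentiableAt hΩ hp)
    (hasFDerivAt_prodMk_right p.1 p.2).differentiableAt

theorem differentiableAt_time (hf : PeriodicSmooth Ω f) (hΩ : IsOpen Ω) (hp : p ∈ Ω) :
    DifferentiableAt ℝ (fun τ => f (τ, p.2)) p.1 :=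
  (hasDerivAt_time (hf.differentiableAt hΩ hp)).differentiableAt

theorem const (c : ℝ) : PeriodicSmooth Ω (fun _ => c) := ⟨contDiffOn_const, fun _ _ _ => rfl⟩

theorem add (hf : PeriodicSmooth Ω f) (hg : PeriodicSmooth Ω g) :
    PeriodicSmooth Ω (fun q => f q + g q) :=
  ⟨hf.1.add hg.1, fun t x k => by rw [hf.2, hg.2]⟩

theorem mul (hf : PeriodicSmooth Ω f) (hg : PeriodicSmooth Ω g) :
    PeriodicSmooth Ω (fun q => f q * g q) :=
  ⟨hf.1.mul hg.1, fun t x k => by rw [hf.2, hg.2]⟩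

theorem const_mul (c : ℝ) (hf : PeriodicSmooth Ω f) : PeriodicSmooth Ω (fun q => c * f q) :=
  (const c).mul hf

theorem sum {ι : Type*} {s : Finset ι} {f : ι → ℝ × Vec d → ℝ}
    (hf : ∀ i, PeriodicSmooth Ω (f i)) : PeriodicSmooth Ω (fun q => ∑ i ∈ s, f i q) :=
  ⟨ContDiffOn.sum fun i _ => (hf i).1, fun t x k => by simp only [(hf _).2]⟩

theorem rpow_const (hf : PeriodicSmooth Ω f) (h0 : ∀ q ∈ Ω, 0 < f q) (a : ℝ) :
    PeriodicSmooth Ω (fun q => f q ^ a) :=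
  ⟨hf.1.rpow_const_of_ne fun q hq => (h0 q hq).ne', fun t x k => by rw [hf.2]⟩

theorem div (hf : PeriodicSmooth Ω f) (hg : PeriodicSmooth Ω g) (h0 : ∀ q ∈ Ω, g q ≠ 0) :
    PeriodicSmooth Ω (fun q => f q / g q) :=
  ⟨hf.1.div hg.1 h0, fun t x k => by rw [hf.2, hg.2]⟩

theorem dx (hf : PeriodicSmooth Ω f) (hΩ : IsOpen Ω) (i : Fin d) :
    PeriodicSmooth Ω (dx i f) where
  contDiffOn := by
    refine ContDiffOn.congr (f := fun q => fderiv ℝ f q (0, Pi.single i 1)) ?_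
      fun q hq => dx_eq_fderiv (hf.differentiableAt hΩ hq) i
    exact (hf.1.fderiv_of_isOpen hΩ (by simp)).clm_apply contDiffOn_const
  periodic t x k := by
    have h := fderiv_comp_add_right (𝕜 := ℝ) (f := fun y => f (t, y)) (x := x)
      (fun i => (k i : ℝ))
    have h' : (fun y : Vec d => f (t, y + fun i => (k i : ℝ))) = fun y => f (t, y) := by
      funext y; exact hf.2 t y k
    rw [h'] at h
    simp only [_root_.dx, pd]
    exact congrArg (fun L : Vec d →L[ℝ] ℝ => L (Pi.single i 1)) h.symm

theorem dt (hf : PeriodicSmooth Ω f) (hΩ : IsOpen Ω) : PeriodicSmooth Ω (dt f) where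
  contDiffOn := by
    refine ContDiffOn.congr (f := fun q => fderiv ℝ f q (1, 0)) ?_
      fun q hq => dt_eq_fderiv (hf.differentiableAt hΩ hq)
    exact (hf.1.fderiv_of_isOpen hΩ (by simp)).clm_apply contDiffOn_const
  periodic t x k := by simp only [_root_.dt, hf.2]

end PeriodicSmooth

theorem dx_const_mul (hΩ : IsOpen Ω) (hp : p ∈ Ω) (hf : PeriodicSmooth Ω f) (c : ℝ)
    (i : Fin d) : dx i (fun q => c * f q) p = c * dx i f p := by
  simp only [dx, pd]
  rw [fderiv_const_mul (hf.differentiableAt_space hΩ hp)]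
  simp

theorem dx_add (hΩ : IsOpen Ω) (hp : p ∈ Ω) (hf : PeriodicSmooth Ω f)
    (hg : PeriodicSmooth Ω g) (i : Fin d) :
    dx i (fun q => f q + g q) p = dx i f p + dx i g p := by
  simp only [dx, pd]
  rw [fderiv_fun_add (hf.differentiableAt_space hΩ hp) (hg.differentiableAt_space hΩ hp)]
  simp

theorem dx_mul (hΩ : IsOpen Ω) (hp : p ∈ Ω) (hf : PeriodicSmooth Ω f)
    (hg : PeriodicSmooth Ω g) (i : Fin d) :
    dx i (fun q => f q * g q) p = dx i f p * g p + f p * dx i g p := by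
  simp only [dx, pd]
  rw [fderiv_fun_mul (hf.differentiableAt_space hΩ hp) (hg.differentiableAt_space hΩ hp)]
  simp
  ring

theorem dx_sum {ι : Type*} {s : Finset ι} {f : ι → ℝ × Vec d → ℝ} (hΩ : IsOpen Ω) (hp : p ∈ Ω)
    (hf : ∀ k, PeriodicSmooth Ω (f k)) (i : Fin d) :
    dx i (fun q => ∑ k ∈ s, f k q) p = ∑ k ∈ s, dx i (f k) p := by
  simp only [dx, pd]
  rw [fderiv_fun_sum fun k _ => (hf k).differentiableAt_space hΩ hp]
  simp

theorem dx_rpow (hΩ : IsOpen Ω) (hp : p ∈ Ω) (hf : PeriodicSmooth Ω f) (h0 : ∀ q ∈ Ω, 0 < f q)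
    (a : ℝ) (i : Fin d) :
    dx i (fun q => f q ^ a) p = a * f p ^ (a - 1) * dx i f p := by
  simp only [dx, pd]
  rw [((hf.differentiableAt_space hΩ hp).hasFDerivAt.rpow_const (Or.inl (h0 p hp).ne')).fderiv]
  simp

theorem dt_const_mul (c : ℝ) : dt (fun q => c * f q) p = c * dt f p := by
  simp only [dt, deriv_const_mul_field]

theorem dt_add (hΩ : IsOpen Ω) (hp : p ∈ Ω) (hf : PeriodicSmooth Ω f)
    (hg : PeriodicSmooth Ω g) : dt (fun q => f q + g q) p = dt f p + dt g p :=
  deriv_fun_add (hf.differentiableAt_time hΩ hp) (hg.differentiableAt_time hΩ hp)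

theorem dt_mul (hΩ : IsOpen Ω) (hp : p ∈ Ω) (hf : PeriodicSmooth Ω f)
    (hg : PeriodicSmooth Ω g) : dt (fun q => f q * g q) p = dt f p * g p + f p * dt g p :=
  deriv_fun_mul (hf.differentiableAt_time hΩ hp) (hg.differentiableAt_time hΩ hp)

theorem dt_sum {ι : Type*} {s : Finset ι} {f : ι → ℝ × Vec d → ℝ} (hΩ : IsOpen Ω) (hp : p ∈ Ω)
    (hf : ∀ k, PeriodicSmooth Ω (f k)) :
    dt (fun q => ∑ k ∈ s, f k q) p = ∑ k ∈ s, dt (f k) p :=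
  deriv_fun_sum fun k _ => (hf k).differentiableAt_time hΩ hp

theorem dt_rpow (hΩ : IsOpen Ω) (hp : p ∈ Ω) (hf : PeriodicSmooth Ω f) (h0 : ∀ q ∈ Ω, 0 < f q)
    (a : ℝ) : dt (fun q => f q ^ a) p = a * f p ^ (a - 1) * dt f p := by
  simp only [dt]
  rw [((hf.differentiableAt_time hΩ hp).hasDerivAt.rpow_const (Or.inl (h0 p hp).ne')).deriv]
  ring

theorem fderiv_clm_apply_const (hΩ : IsOpen Ω) (hp : p ∈ Ω) (hf : PeriodicSmooth Ω f)
    (a b : ℝ × Vec d) :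
    fderiv ℝ (fun q => fderiv ℝ f q a) p b = fderiv ℝ (fderiv ℝ f) p b a := by
  have h : DifferentiableAt ℝ (fderiv ℝ f) p :=
    ((hf.1.fderiv_of_isOpen hΩ (m := (⊤ : ℕ∞)) (by simp)).contDiffAt
      (hΩ.mem_nhds hp)).differentiableAt (by simp)
  rw [fderiv_clm_apply h (differentiableAt_const a)]
  simp

theorem fderiv_fderiv_comm (hΩ : IsOpen Ω) (hp : p ∈ Ω) (hf : PeriodicSmooth Ω f)
    (a b : ℝ × Vec d) :
    fderiv ℝ (fderiv ℝ f) p a b = fderiv ℝ (fderiv ℝ f) p b a :=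
  (hf.contDiffAt hΩ hp).isSymmSndFDerivAt (by simpa using WithTop.coe_le_coe.2 (le_top : (2 : ℕ∞) ≤ ⊤)) a b

theorem dx_dx_comm (hΩ : IsOpen Ω) (hp : p ∈ Ω) (hf : PeriodicSmooth Ω f) (i j : Fin d) :
    dx i (dx j f) p = dx j (dx i f) p := by
  have key : ∀ i j : Fin d, dx i (dx j f) p
      = fderiv ℝ (fderiv ℝ f) p (0, Pi.single i 1) (0, Pi.single j 1) := fun i j => by
    rw [dx_eq_fderiv ((hf.dx hΩ j).differentiableAt hΩ hp),
      ← fderiv_clm_apply_const hΩ hp hf]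
    refine congrArg (fun L : ℝ × Vec d →L[ℝ] ℝ => L (0, Pi.single i 1))
      (Filter.EventuallyEq.fderiv_eq ?_)
    filter_upwards [hΩ.mem_nhds hp] with q hq
    exact dx_eq_fderiv (hf.differentiableAt hΩ hq) j
  rw [key, key, fderiv_fderiv_comm hΩ hp hf]

theorem dt_dx_comm (hΩ : IsOpen Ω) (hp : p ∈ Ω) (hf : PeriodicSmooth Ω f) (i : Fin d) :
    dt (dx i f) p = dx i (dt f) p := by
  rw [dt_eq_fderiv ((hf.dx hΩ i).differentiableAt hΩ hp),
    dx_eq_fderiv ((hf.dt hΩ).differentiableAt hΩ hp)]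
  have h₁ : dx i f =ᶠ[nhds p] fun q => fderiv ℝ f q (0, Pi.single i 1) := by
    filter_upwards [hΩ.mem_nhds hp] with q hq
    exact dx_eq_fderiv (hf.differentiableAt hΩ hq) i
  have h₂ : dt f =ᶠ[nhds p] fun q => fderiv ℝ f q (1, 0) := by
    filter_upwards [hΩ.mem_nhds hp] with q hq
    exact dt_eq_fderiv (hf.differentiableAt hΩ hq)
  rw [h₁.fderiv_eq, h₂.fderiv_eq, fderiv_clm_apply_const hΩ hp hf,
    fderiv_clm_apply_const hΩ hp hf, fderiv_fderiv_comm hΩ hp hf]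

theorem dx_congr_of_eqOn (hΩ : IsOpen Ω) (hp : p ∈ Ω) (h : Set.EqOn f g Ω) (i : Fin d) :
    dx i f p = dx i g p := by
  have hev : (fun y => f (p.1, y)) =ᶠ[nhds p.2] fun y => g (p.1, y) := by
    have hc : ContinuousAt (fun y => (p.1, y)) p.2 := by fun_prop
    filter_upwards [hc.preimage_mem_nhds (hΩ.mem_nhds hp)] with y hy using h hy
  simp only [dx, pd, hev.fderiv_eq]

theorem dt_congr_of_eqOn (hΩ : IsOpen Ω) (hp : p ∈ Ω) (h : Set.EqOn f g Ω) :
    dt f p = dt g p := by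
  have hev : (fun y => f (y, p.2)) =ᶠ[nhds p.1] fun y => g (y, p.2) := by
    have hc : ContinuousAt (fun y => (y, p.2)) p.1 := by fun_prop
    filter_upwards [hc.preimage_mem_nhds (hΩ.mem_nhds hp)] with y hy using h hy
  exact hev.deriv_eq

end Calculus

theorem integral_sum_dx_eq_zero {d : ℕ} (hd : 1 ≤ d) {Ω : Set (ℝ × Vec d)} (hΩ : IsOpen Ω)
    {F : Fin d → ℝ × Vec d → ℝ} (hF : ∀ j, PeriodicSmooth Ω (F j)) {t : ℝ}
    (ht : ∀ x, (t, x) ∈ Ω) : ∫ x in Box d, ∑ j, dx j (F j) (t, x) = 0 := by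
  obtain ⟨n, rfl⟩ : ∃ n, d = n + 1 := ⟨d - 1, by omega⟩
  have hcont : ∀ {f}, PeriodicSmooth Ω f → Continuous fun x => f (t, x) := fun hf =>
    continuous_iff_continuousAt.2 fun x =>
      (hf.differentiableAt_space hΩ (ht x)).continuousAt
  have h := integral_divergence_of_hasFDerivAt_off_countable' (0 : Vec (n + 1)) 1
    zero_le_one (fun j x => F j (t, x)) (fun j x => fderiv ℝ (fun y => F j (t, y)) x) ∅
    Set.countable_empty (fun j => (hcont (hF j)).continuousOn)
    (fun x _ j => ((hF j).differentiableAt_space hΩ (ht x)).hasFDerivAt)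
    ((continuous_finsetSum _ fun j _ => hcont ((hF j).dx hΩ j)).continuousOn.integrableOn_compact
      isCompact_Icc)
  refine Eq.trans h (Finset.sum_eq_zero fun j _ => sub_eq_zero.2 ?_)
  congr 1
  funext x
  have h1 := (hF j).2 t (j.insertNth 0 x) (Pi.single j 1)
  refine Eq.trans (congrArg (fun y => F j (t, y)) ?_) h1
  funext k
  refine Fin.succAboveCases j ?_ (fun k => ?_) k <;> simp

/-- `g` agrees on `S` with the space divergence of a smooth periodic flux. -/
def IsSpatialDiv {d : ℕ} (Ω S : Set (ℝ × Vec d)) (g : ℝ × Vec d → ℝ) : Prop :=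
  ∃ F : Fin d → ℝ × Vec d → ℝ, (∀ j, PeriodicSmooth Ω (F j)) ∧
    ∀ p ∈ S, g p = ∑ j, dx j (F j) p

section Divergence

variable {d : ℕ} {Ω S : Set (ℝ × Vec d)} {f g : ℝ × Vec d → ℝ} {p : ℝ × Vec d}

namespace IsSpatialDiv

theorem congr (hf : IsSpatialDiv Ω S f) (h : ∀ p ∈ S, g p = f p) : IsSpatialDiv Ω S g :=
  let ⟨F, hF, hd⟩ := hf
  ⟨F, hF, fun p hp => (h p hp).trans (hd p hp)⟩

theorem add (hΩ : IsOpen Ω) (hS : S ⊆ Ω) (hf : IsSpatialDiv Ω S f) (hg : IsSpatialDiv Ω S g) :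
    IsSpatialDiv Ω S (fun p => f p + g p) := by
  obtain ⟨F, hF, hf⟩ := hf
  obtain ⟨G, hG, hg⟩ := hg
  refine ⟨fun j q => F j q + G j q, fun j => (hF j).add (hG j), fun p hp => ?_⟩
  beta_reduce
  rw [hf p hp, hg p hp, ← Finset.sum_add_distrib]
  exact Finset.sum_congr rfl fun j _ => (dx_add hΩ (hS hp) (hF j) (hG j) j).symm

theorem const_mul (hΩ : IsOpen Ω) (hS : S ⊆ Ω) (c : ℝ) (hf : IsSpatialDiv Ω S f) :
    IsSpatialDiv Ω S (fun p => c * f p) := by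
  obtain ⟨F, hF, hf⟩ := hf
  refine ⟨fun j q => c * F j q, fun j => (hF j).const_mul c, fun p hp => ?_⟩
  beta_reduce
  rw [hf p hp, Finset.mul_sum]
  exact Finset.sum_congr rfl fun j _ => (dx_const_mul hΩ (hS hp) (hF j) c j).symm

theorem sum {ι : Type*} {s : Finset ι} {f : ι → ℝ × Vec d → ℝ} (hΩ : IsOpen Ω) (hS : S ⊆ Ω)
    (hf : ∀ i, IsSpatialDiv Ω S (f i)) : IsSpatialDiv Ω S (fun p => ∑ i ∈ s, f i p) := by
  choose F hF hf using hf
  refine ⟨fun j q => ∑ i ∈ s, F i j q, fun j => .sum fun i => hF i j, fun p hp => ?_⟩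
  simp only [hf _ p hp]
  rw [Finset.sum_comm]
  exact Finset.sum_congr rfl fun j _ => (dx_sum hΩ (hS hp) (fun i => hF i j) j).symm

/-- Integration by parts of a matrix field against a vector field. -/
theorem matrix (hΩ : IsOpen Ω) (hS : S ⊆ Ω) {A : Fin d → Fin d → ℝ × Vec d → ℝ}
    {b : Fin d → ℝ × Vec d → ℝ} (hA : ∀ i j, PeriodicSmooth Ω (A i j))
    (hb : ∀ i, PeriodicSmooth Ω (b i)) :
    IsSpatialDiv Ω S (fun p => (∑ i, b i p * ∑ j, dx j (A i j) p)
      + ∑ i, ∑ j, A i j p * dx j (b i) p) := by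
  refine ⟨fun j q => ∑ i, A i j q * b i q, fun j => .sum fun i => (hA i j).mul (hb i),
    fun p hp => ?_⟩
  simp only [dx_sum hΩ (hS hp) (fun i => (hA i _).mul (hb i)),
    dx_mul hΩ (hS hp) (hA _ _) (hb _)]
  rw [← Finset.sum_add_distrib]
  conv_rhs => rw [Finset.sum_comm]
  refine Finset.sum_congr rfl fun i _ => ?_
  rw [Finset.mul_sum, ← Finset.sum_add_distrib]
  exact Finset.sum_congr rfl fun j _ => by ring

/-- Integration by parts of a scalar field against a vector field. -/
theorem scalar (hΩ : IsOpen Ω) (hS : S ⊆ Ω) {q : ℝ × Vec d → ℝ} {b : Fin d → ℝ × Vec d → ℝ}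
    (hq : PeriodicSmooth Ω q) (hb : ∀ i, PeriodicSmooth Ω (b i)) :
    IsSpatialDiv Ω S (fun p => (∑ i, b i p * dx i q p) + q p * ∑ i, dx i (b i) p) := by
  refine ⟨fun j z => q z * b j z, fun j => hq.mul (hb j), fun p hp => ?_⟩
  simp only [dx_mul hΩ (hS hp) hq (hb _)]
  rw [Finset.mul_sum, ← Finset.sum_add_distrib]
  exact Finset.sum_congr rfl fun j _ => by ring

/-- Kinetic energy balance for a field `a` transported by the momentum `R U`. -/
theorem kinetic (hΩ : IsOpen Ω) (hS : S ⊆ Ω) {R a : ℝ × Vec d → ℝ} {U : Fin d → ℝ × Vec d → ℝ}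
    (hR : PeriodicSmooth Ω R) (ha : PeriodicSmooth Ω a) (hU : ∀ i, PeriodicSmooth Ω (U i))
    (hmass : ∀ p ∈ S, dt R p + ∑ j, dx j (fun q => R q * U j q) p = 0) :
    IsSpatialDiv Ω S (fun p => dt (fun q => R q * a q * a q) p
      - 2 * a p * (dt (fun q => R q * a q) p + ∑ j, dx j (fun q => R q * a q * U j q) p)) := by
  refine ⟨fun j q => -1 * (R q * a q * a q * U j q),
    fun j => (((hR.mul ha).mul ha).mul (hU j)).const_mul _, fun p hp => ?_⟩
  have hx : ∀ j, dx j (fun q => -1 * (R q * a q * a q * U j q)) p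
      = a p ^ 2 * dx j (fun q => R q * U j q) p
        - 2 * a p * dx j (fun q => R q * a q * U j q) p := fun j => by
    rw [dx_const_mul hΩ (hS hp) (((hR.mul ha).mul ha).mul (hU j)),
      dx_mul hΩ (hS hp) ((hR.mul ha).mul ha) (hU j), dx_mul hΩ (hS hp) (hR.mul ha) ha,
      dx_mul hΩ (hS hp) (hR.mul ha) (hU j), dx_mul hΩ (hS hp) hR ha,
      dx_mul hΩ (hS hp) hR (hU j)]
    ring
  simp only [hx, Finset.sum_sub_distrib, ← Finset.mul_sum]
  rw [dt_mul hΩ (hS hp) (hR.mul ha) ha, dt_mul hΩ (hS hp) hR ha]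
  linear_combination -a p ^ 2 * hmass p hp

/-- Potential energy balance for the pressure law `R ^ γ`. -/
theorem potential (hΩ : IsOpen Ω) (hS : S ⊆ Ω) {R : ℝ × Vec d → ℝ} {U : Fin d → ℝ × Vec d → ℝ}
    (hR : PeriodicSmooth Ω R) (h0 : ∀ q ∈ Ω, 0 < R q) (hU : ∀ i, PeriodicSmooth Ω (U i))
    (hmass : ∀ p ∈ S, dt R p + ∑ j, dx j (fun q => R q * U j q) p = 0) {γ : ℝ} (hγ : γ ≠ 1) :
    IsSpatialDiv Ω S (fun p => dt (fun q => (γ - 1)⁻¹ * R q ^ γ) p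
      - ∑ i, U i p * dx i (fun q => R q ^ γ) p) := by
  have hP := hR.rpow_const h0 γ
  have hγ' : γ - 1 ≠ 0 := sub_ne_zero.2 hγ
  refine ⟨fun j q => (-(γ / (γ - 1))) * (R q ^ γ * U j q),
    fun j => (hP.mul (hU j)).const_mul _, fun p hp => ?_⟩
  have hpow : R p ^ γ = R p ^ (γ - 1) * R p := by
    rw [Real.rpow_sub_one (h0 p (hS hp)).ne']
    field_simp [(h0 p (hS hp)).ne']
  have hx : ∀ j, dx j (fun q => (-(γ / (γ - 1))) * (R q ^ γ * U j q)) p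
      = (-(γ / (γ - 1)) * R p ^ (γ - 1)) * dx j (fun q => R q * U j q) p
        - U j p * dx j (fun q => R q ^ γ) p := fun j => by
    rw [dx_const_mul hΩ (hS hp) (hP.mul (hU j)), dx_mul hΩ (hS hp) hP (hU j),
      dx_mul hΩ (hS hp) hR (hU j), dx_rpow hΩ (hS hp) hR h0, hpow]
    field_simp
    ring
  simp only [hx, Finset.sum_sub_distrib, ← Finset.mul_sum]
  rw [dt_const_mul, dt_rpow hΩ (hS hp) hR h0]
  linear_combination (γ / (γ - 1) * R p ^ (γ - 1)) * hmass p hp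

end IsSpatialDiv
end Divergence

section Stress

variable {d : ℕ}

/-- Space divergence `div a`. -/
def spaceDiv (a : Fin d → ℝ × Vec d → ℝ) (p : ℝ × Vec d) : ℝ := ∑ j, dx j (a j) p

/-- The `i`-th component of `div (M ∇a)`. -/
def gradStress (M : ℝ × Vec d → ℝ) (a : Fin d → ℝ × Vec d → ℝ) (i : Fin d) (p : ℝ × Vec d) : ℝ :=
  ∑ j, dx j (fun q => M q * dx j (a i) q) p

/-- The `i`-th component of `div (M ᵗ∇a)`. -/
def transStress (M : ℝ × Vec d → ℝ) (a : Fin d → ℝ × Vec d → ℝ) (i : Fin d) (p : ℝ × Vec d) : ℝ :=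
  ∑ j, dx j (fun q => M q * dx i (a j) q) p

/-- The `i`-th component of `∇(L div a)`. -/
def bulkStress (L : ℝ × Vec d → ℝ) (a : Fin d → ℝ × Vec d → ℝ) (i : Fin d) (p : ℝ × Vec d) : ℝ :=
  dx i (fun q => L q * spaceDiv a q) p

/-- The `i`-th component of `∂ₜ(R a) + div(R a ⊗ U)`. -/
def transport (R : ℝ × Vec d → ℝ) (U a : Fin d → ℝ × Vec d → ℝ) (i : Fin d) (p : ℝ × Vec d) : ℝ :=
  dt (fun q => R q * a i q) p + ∑ j, dx j (fun q => R q * a i q * U j q) p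

variable {Ω S : Set (ℝ × Vec d)} {p : ℝ × Vec d} {R M L : ℝ × Vec d → ℝ}
  {a b U V : Fin d → ℝ × Vec d → ℝ}

theorem PeriodicSmooth.spaceDiv (hΩ : IsOpen Ω) (ha : ∀ i, PeriodicSmooth Ω (a i)) :
    PeriodicSmooth Ω (spaceDiv a) :=
  PeriodicSmooth.sum fun i => (ha i).dx hΩ i

theorem dx_add_const_mul (hΩ : IsOpen Ω) (hp : p ∈ Ω) {f g : ℝ × Vec d → ℝ}
    (hf : PeriodicSmooth Ω f) (hg : PeriodicSmooth Ω g) (c : ℝ) (i : Fin d) :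
    dx i (fun q => f q + c * g q) p = dx i f p + c * dx i g p := by
  rw [dx_add hΩ hp hf (hg.const_mul c), dx_const_mul hΩ hp hg]

theorem dx_mul_dx_add_const_mul (hΩ : IsOpen Ω) (hp : p ∈ Ω) (hM : PeriodicSmooth Ω M)
    {f g : ℝ × Vec d → ℝ} (hf : PeriodicSmooth Ω f) (hg : PeriodicSmooth Ω g) (c : ℝ)
    (i j : Fin d) :
    dx j (fun q => M q * dx i (fun z => f z + c * g z) q) p
      = dx j (fun q => M q * dx i f q) p + c * dx j (fun q => M q * dx i g q) p := by
  rw [← dx_add_const_mul hΩ hp (hM.mul (hf.dx hΩ i)) (hM.mul (hg.dx hΩ i))]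
  refine dx_congr_of_eqOn hΩ hp (fun q hq => ?_) j
  simp only [dx_add_const_mul hΩ hq hf hg]
  ring

theorem gradStress_add_const_mul (hΩ : IsOpen Ω) (hp : p ∈ Ω) (hM : PeriodicSmooth Ω M)
    (hU : ∀ i, PeriodicSmooth Ω (U i)) (hV : ∀ i, PeriodicSmooth Ω (V i)) (c : ℝ) (i : Fin d) :
    gradStress M (fun k q => U k q + c * V k q) i p
      = gradStress M U i p + c * gradStress M V i p := by
  simp only [gradStress, dx_mul_dx_add_const_mul hΩ hp hM (hU i) (hV i), Finset.sum_add_distrib,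
    Finset.mul_sum]

theorem transStress_add_const_mul (hΩ : IsOpen Ω) (hp : p ∈ Ω) (hM : PeriodicSmooth Ω M)
    (hU : ∀ i, PeriodicSmooth Ω (U i)) (hV : ∀ i, PeriodicSmooth Ω (V i)) (c : ℝ) (i : Fin d) :
    transStress M (fun k q => U k q + c * V k q) i p
      = transStress M U i p + c * transStress M V i p := by
  simp only [transStress, dx_mul_dx_add_const_mul hΩ hp hM (hU _) (hV _), Finset.sum_add_distrib,
    Finset.mul_sum]

theorem bulkStress_add_const_mul (hΩ : IsOpen Ω) (hp : p ∈ Ω) (hL : PeriodicSmooth Ω L)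
    (hU : ∀ i, PeriodicSmooth Ω (U i)) (hV : ∀ i, PeriodicSmooth Ω (V i)) (c : ℝ) (i : Fin d) :
    bulkStress L (fun k q => U k q + c * V k q) i p
      = bulkStress L U i p + c * bulkStress L V i p := by
  simp only [bulkStress]
  rw [← dx_add_const_mul hΩ hp (hL.mul (.spaceDiv hΩ hU)) (hL.mul (.spaceDiv hΩ hV))]
  refine dx_congr_of_eqOn hΩ hp (fun q hq => ?_) i
  simp only [spaceDiv, dx_add_const_mul hΩ hq (hU _) (hV _), Finset.sum_add_distrib,
    ← Finset.mul_sum]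
  ring

theorem transport_add_const_mul (hΩ : IsOpen Ω) (hp : p ∈ Ω) (hR : PeriodicSmooth Ω R)
    (hU : ∀ i, PeriodicSmooth Ω (U i)) (ha : ∀ i, PeriodicSmooth Ω (a i))
    (hV : ∀ i, PeriodicSmooth Ω (V i)) (c : ℝ) (i : Fin d) :
    transport R U (fun k q => a k q + c * V k q) i p
      = transport R U a i p + c * transport R U V i p := by
  have h₁ : (fun q => R q * (a i q + c * V i q))
      = fun q => R q * a i q + c * (R q * V i q) := by funext q; ring
  have h₂ : ∀ j, (fun q => R q * (a i q + c * V i q) * U j q)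
      = fun q => R q * a i q * U j q + c * (R q * V i q * U j q) := fun j => by funext q; ring
  simp only [transport, h₁, h₂]
  rw [dt_add hΩ hp (hR.mul (ha i)) ((hR.mul (hV i)).const_mul c), dt_const_mul]
  simp only [dx_add_const_mul hΩ hp ((hR.mul (ha i)).mul (hU _)) ((hR.mul (hV i)).mul (hU _)),
    Finset.sum_add_distrib, ← Finset.mul_sum]
  ring

theorem transStress_eq_gradStress (hΩ : IsOpen Ω) (hp : p ∈ Ω)
    (hcurl : ∀ i j, ∀ q ∈ Ω, dx i (a j) q = dx j (a i) q) (i : Fin d) :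
    transStress M a i p = gradStress M a i p :=
  Finset.sum_congr rfl fun j _ =>
    dx_congr_of_eqOn hΩ hp (fun q hq => by simp only [hcurl i j q hq]) j

theorem sum_dx_mul_symmGrad (hΩ : IsOpen Ω) (hp : p ∈ Ω) (hM : PeriodicSmooth Ω M)
    (ha : ∀ i, PeriodicSmooth Ω (a i)) (i : Fin d) :
    ∑ j, dx j (fun q => M q * (1 / 2 * (dx j (a i) q + dx i (a j) q))) p
      = 1 / 2 * (gradStress M a i p + transStress M a i p) := by
  simp only [gradStress, transStress]
  rw [← Finset.sum_add_distrib, Finset.mul_sum]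
  refine Finset.sum_congr rfl fun j _ => ?_
  have h : (fun q => M q * (1 / 2 * (dx j (a i) q + dx i (a j) q)))
      = fun q => 1 / 2 * (M q * dx j (a i) q + M q * dx i (a j) q) := by funext q; ring
  have h₁ := hM.mul ((ha i).dx hΩ j)
  have h₂ := hM.mul ((ha j).dx hΩ i)
  rw [h, dx_const_mul hΩ hp (h₁.add h₂), dx_add hΩ hp h₁ h₂]

/-- Conservation of mass implies the evolution equation of `R V = ∇(R ^ m)`. -/
theorem transport_velocity (hΩ : IsOpen Ω) (hS : S ⊆ Ω)
    (hslice : ∀ p ∈ S, ∀ y, (p.1, y) ∈ S) (hp : p ∈ S)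
    (hR : PeriodicSmooth Ω R) (h0 : ∀ q ∈ Ω, 0 < R q)
    (hU : ∀ i, PeriodicSmooth Ω (U i))
    (hmass : ∀ p ∈ S, dt R p + ∑ j, dx j (fun q => R q * U j q) p = 0) {m : ℝ}
    (hLs : PeriodicSmooth Ω L) (hL : ∀ q ∈ Ω, L q = 2 * (m - 1) * R q ^ m)
    (hV : ∀ i, ∀ q ∈ Ω, R q * V i q = dx i (fun q => R q ^ m) q) (i : Fin d) :
    transport R U V i p
      = -transStress (fun q => R q ^ m) U i p - 1 / 2 * bulkStress L U i p := by
  have hM := hR.rpow_const h0 m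
  set M : ℝ × Vec d → ℝ := fun q => R q ^ m with hMdef
  have hpΩ := hS hp
  have hMU := fun j => hM.mul (hU j)
  have hLU := hLs.mul (.spaceDiv hΩ hU)
  have hdtM : ∀ q ∈ S, dt M q
      = -1 * (∑ j, dx j (fun z => M z * U j z) q) + (-(1 / 2)) * (L q * spaceDiv U q) := by
    intro q hq
    have hqΩ := hS hq
    have hpow : M q = R q ^ (m - 1) * R q := by
      simp only [hMdef]
      rw [Real.rpow_sub_one (h0 q hqΩ).ne']
      field_simp [(h0 q hqΩ).ne']
    have hj : ∀ j, dx j (fun z => M z * U j z) q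
        = m * R q ^ (m - 1) * dx j (fun z => R z * U j z) q
          - (m - 1) * M q * dx j (U j) q := fun j => by
      rw [dx_mul hΩ hqΩ hM (hU j), dx_mul hΩ hqΩ hR (hU j), dx_rpow hΩ hqΩ hR h0, hpow]
      ring
    rw [dt_rpow hΩ hqΩ hR h0, hL q hqΩ]
    simp only [hj, Finset.sum_sub_distrib, ← Finset.mul_sum, spaceDiv]
    linear_combination m * R q ^ (m - 1) * hmass q hq
  have h₁ : dt (fun q => R q * V i q) p
      = -(∑ j, dx i (dx j (fun z => M z * U j z)) p) - 1 / 2 * bulkStress L U i p := by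
    rw [dt_congr_of_eqOn hΩ hpΩ (hV i), dt_dx_comm hΩ hpΩ hM,
      dx_congr (g := fun q => -1 * (∑ j, dx j (fun z => M z * U j z) q)
          + (-(1 / 2)) * (L q * spaceDiv U q)) (fun y => hdtM (p.1, y) (hslice p hp y)),
      dx_add_const_mul hΩ hpΩ ((PeriodicSmooth.sum fun j => (hMU j).dx hΩ j).const_mul (-1)) hLU,
      dx_const_mul hΩ hpΩ (PeriodicSmooth.sum fun j => (hMU j).dx hΩ j),
      dx_sum hΩ hpΩ (fun j => (hMU j).dx hΩ j), bulkStress]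
    ring
  have h₂ : ∀ j, dx i (dx j (fun z => M z * U j z)) p
      = dx j (fun q => R q * V i q * U j q) p + dx j (fun q => M q * dx i (U j) q) p := fun j => by
    rw [dx_dx_comm hΩ hpΩ (hMU j), dx_congr_of_eqOn hΩ hpΩ
        (fun q hq => by rw [dx_mul hΩ hq hM (hU j)] :
          Set.EqOn _ (fun q => dx i M q * U j q + M q * dx i (U j) q) Ω),
      dx_add hΩ hpΩ ((hM.dx hΩ i).mul (hU j)) (hM.mul ((hU j).dx hΩ i))]
    congr 1
    exact dx_congr_of_eqOn hΩ hpΩ (fun q hq => by simp only [hV i q hq]) j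
  simp only [transport, transStress, h₁, h₂, Finset.sum_add_distrib]
  ring

theorem curl_velocity (hΩ : IsOpen Ω) (hR : PeriodicSmooth Ω R) (h0 : ∀ q ∈ Ω, 0 < R q) {m : ℝ}
    (hVs : ∀ i, PeriodicSmooth Ω (V i))
    (hV : ∀ i, ∀ q ∈ Ω, R q * V i q = dx i (fun q => R q ^ m) q) (i j : Fin d) (hp : p ∈ Ω) :
    dx i (V j) p = dx j (V i) p := by
  have key : ∀ i j, dx i R p * V j p + R p * dx i (V j) p
      = dx i (dx j (fun q => R q ^ m)) p := fun i j => by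
    rw [← dx_mul hΩ hp hR (hVs j)]
    exact dx_congr_of_eqOn hΩ hp (hV j) i
  have h₁ := key i j
  rw [dx_dx_comm hΩ hp (hR.rpow_const h0 m), ← key j i] at h₁
  have h₂ := hV i p hp
  have h₃ := hV j p hp
  rw [dx_rpow hΩ hp hR h0] at h₂ h₃
  have hR0 := (h0 p hp).ne'
  apply mul_left_cancel₀ (mul_ne_zero hR0 hR0)
  linear_combination R p * h₁ - dx i R p * h₃ + dx j R p * h₂

/-- Integration by parts for the stress `M ∇a + ½ L (div a) I`. -/
theorem IsSpatialDiv.gradStress (hΩ : IsOpen Ω) (hS : S ⊆ Ω) (hM : PeriodicSmooth Ω M)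
    (hL : PeriodicSmooth Ω L) (ha : ∀ i, PeriodicSmooth Ω (a i))
    (hb : ∀ i, PeriodicSmooth Ω (b i)) :
    IsSpatialDiv Ω S (fun p =>
      (∑ i, b i p * (gradStress M a i p + 1 / 2 * bulkStress L a i p))
        + (M p * (∑ i, ∑ j, dx j (a i) p * dx j (b i) p)
          + 1 / 2 * L p * (spaceDiv a p * spaceDiv b p))) := by
  refine ((IsSpatialDiv.matrix hΩ hS (fun i j => hM.mul ((ha i).dx hΩ j)) hb).add hΩ hS
    ((IsSpatialDiv.scalar hΩ hS (hL.mul (.spaceDiv hΩ ha)) hb).const_mul hΩ hS (1 / 2))).congr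
    fun p _ => ?_
  simp only [_root_.gradStress, bulkStress, mul_add, Finset.sum_add_distrib, Finset.mul_sum,
    show spaceDiv b p = ∑ i, dx i (b i) p from rfl]
  ring_nf

/-- Integration by parts for the stress `M ᵗ∇a + ½ L (div a) I`. -/
theorem IsSpatialDiv.transStress (hΩ : IsOpen Ω) (hS : S ⊆ Ω) (hM : PeriodicSmooth Ω M)
    (hL : PeriodicSmooth Ω L) (ha : ∀ i, PeriodicSmooth Ω (a i))
    (hb : ∀ i, PeriodicSmooth Ω (b i)) :
    IsSpatialDiv Ω S (fun p =>
      (∑ i, b i p * (transStress M a i p + 1 / 2 * bulkStress L a i p))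
        + (M p * (∑ i, ∑ j, dx i (a j) p * dx j (b i) p)
          + 1 / 2 * L p * (spaceDiv a p * spaceDiv b p))) := by
  refine ((IsSpatialDiv.matrix hΩ hS (fun i j => hM.mul ((ha j).dx hΩ i)) hb).add hΩ hS
    ((IsSpatialDiv.scalar hΩ hS (hL.mul (.spaceDiv hΩ ha)) hb).const_mul hΩ hS (1 / 2))).congr
    fun p _ => ?_
  simp only [_root_.transStress, bulkStress, mul_add, Finset.sum_add_distrib, Finset.mul_sum,
    show spaceDiv b p = ∑ i, dx i (b i) p from rfl]
  ring_nf

end Stress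

section Energy

variable {d : ℕ} {Ω S : Set (ℝ × Vec d)} {R L : ℝ × Vec d → ℝ} {U V : Fin d → ℝ × Vec d → ℝ}
  {m ν ε γ : ℝ}

theorem isSpatialDiv_energy_balance (hΩ : IsOpen Ω) (hS : S ⊆ Ω)
    (hslice : ∀ p ∈ S, ∀ y, (p.1, y) ∈ S)
    (hR : PeriodicSmooth Ω R) (h0 : ∀ q ∈ Ω, 0 < R q)
    (hU : ∀ i, PeriodicSmooth Ω (U i))
    (hmass : ∀ p ∈ S, dt R p + ∑ j, dx j (fun q => R q * U j q) p = 0)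
    (hLs : PeriodicSmooth Ω L) (hL : ∀ q ∈ Ω, L q = 2 * (m - 1) * R q ^ m)
    (hVs : ∀ i, PeriodicSmooth Ω (V i))
    (hV : ∀ i, ∀ q ∈ Ω, R q * V i q = dx i (fun q => R q ^ m) q) (hγ : γ ≠ 1)
    (hmom : ∀ p ∈ S, ∀ i, transport R U U i p + dx i (fun q => R q ^ γ) p
      - ν * (gradStress (fun q => R q ^ m) U i p + transStress (fun q => R q ^ m) U i p)
      - ν * bulkStress L U i p
      = ε ^ 2 * (transStress (fun q => R q ^ m) V i p + 1 / 2 * bulkStress L V i p))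
    {W : Fin d → ℝ × Vec d → ℝ} (hW : W = fun i q => U i q + ν * V i q) :
    IsSpatialDiv Ω S (fun p =>
      1 / 2 * (ε ^ 2 - ν ^ 2) * (∑ i, dt (fun q => R q * V i q * V i q) p)
        + 1 / 2 * (∑ i, dt (fun q => R q * W i q * W i q) p)
        + dt (fun q => (γ - 1)⁻¹ * R q ^ γ) p
        + ν * (∑ i, V i p * dx i (fun q => R q ^ γ) p)
        + ν * (R p ^ m * ((∑ i, ∑ j, (dx j (W i) p) ^ 2)
              + (ε ^ 2 - ν ^ 2) * (∑ i, ∑ j, (dx j (V i) p) ^ 2))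
            + L p / 2 * ((ε ^ 2 - ν ^ 2) * spaceDiv V p ^ 2 + spaceDiv W p ^ 2))) := by
  have hM := hR.rpow_const h0 m
  have hWs : ∀ i, PeriodicSmooth Ω (W i) := fun i => by
    rw [hW]; exact (hU i).add ((hVs i).const_mul ν)
  have hcurl : ∀ i j, ∀ q ∈ Ω, dx i (V j) q = dx j (V i) q := fun i j q hq =>
    curl_velocity hΩ hR h0 hVs hV i j hq
  have hNV : ∀ p ∈ S, ∀ i, transport R U V i p
      = -1 * (transStress (fun q => R q ^ m) W i p + 1 / 2 * bulkStress L W i p)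
        + ν * (gradStress (fun q => R q ^ m) V i p + 1 / 2 * bulkStress L V i p) := by
    intro p hp i
    rw [transport_velocity hΩ hS hslice hp hR h0 hU hmass hLs hL hV, hW,
      transStress_add_const_mul hΩ (hS hp) hM hU hVs, bulkStress_add_const_mul hΩ (hS hp) hLs hU hVs,
      transStress_eq_gradStress hΩ (hS hp) hcurl]
    ring
  have hNW : ∀ p ∈ S, ∀ i, transport R U W i p
      = -1 * dx i (fun q => R q ^ γ) p
        + (ε ^ 2 - ν ^ 2) * (gradStress (fun q => R q ^ m) V i p + 1 / 2 * bulkStress L V i p)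
        + ν * (gradStress (fun q => R q ^ m) W i p + 1 / 2 * bulkStress L W i p) := by
    intro p hp i
    have h := hmom p hp i
    rw [transStress_eq_gradStress (a := V) hΩ (hS hp) hcurl] at h
    rw [hW, transport_add_const_mul hΩ (hS hp) hR hU hU hVs,
      transport_velocity hΩ hS hslice hp hR h0 hU hmass hLs hL hV,
      gradStress_add_const_mul hΩ (hS hp) hM hU hVs, bulkStress_add_const_mul hΩ (hS hp) hLs hU hVs]
    linear_combination h
  have kin : ∀ {a : Fin d → ℝ × Vec d → ℝ}, (∀ i, PeriodicSmooth Ω (a i)) →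
      IsSpatialDiv Ω S (fun p => ∑ i, (dt (fun q => R q * a i q * a i q) p
        - 2 * a i p * transport R U a i p)) := fun ha =>
    .sum hΩ hS fun i => .kinetic hΩ hS hR (ha i) hU hmass
  have hVW := (IsSpatialDiv.gradStress hΩ hS hM hLs hVs hWs)
  have hWV := (IsSpatialDiv.transStress hΩ hS hM hLs hWs hVs)
  have hVV := (IsSpatialDiv.gradStress hΩ hS hM hLs hVs hVs)
  have hWW := (IsSpatialDiv.gradStress hΩ hS hM hLs hWs hWs)
  refine (((kin hVs).const_mul hΩ hS (1 / 2 * (ε ^ 2 - ν ^ 2))).add hΩ hS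
    ((kin hWs).const_mul hΩ hS (1 / 2))
    |>.add hΩ hS (.potential hΩ hS hR h0 hU hmass hγ)
    |>.add hΩ hS (hWV.const_mul hΩ hS (-(ε ^ 2 - ν ^ 2)))
    |>.add hΩ hS (hVV.const_mul hΩ hS ((ε ^ 2 - ν ^ 2) * ν))
    |>.add hΩ hS (hVW.const_mul hΩ hS (ε ^ 2 - ν ^ 2))
    |>.add hΩ hS (hWW.const_mul hΩ hS ν)).congr fun p hp => ?_
  have hsym : (∑ i, ∑ j, dx i (W j) p * dx j (V i) p) = ∑ i, ∑ j, dx j (V i) p * dx j (W i) p := by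
    rw [Finset.sum_comm]
    refine Finset.sum_congr rfl fun i _ => Finset.sum_congr rfl fun j _ => ?_
    rw [hcurl i j p (hS hp)]
    ring
  have hPV : (∑ i, V i p * transport R U V i p)
      = -1 * (∑ i, V i p * (transStress (fun q => R q ^ m) W i p + 1 / 2 * bulkStress L W i p))
        + ν * ∑ i, V i p * (gradStress (fun q => R q ^ m) V i p + 1 / 2 * bulkStress L V i p) := by
    rw [Finset.mul_sum, Finset.mul_sum, ← Finset.sum_add_distrib]
    exact Finset.sum_congr rfl fun i _ => by rw [hNV p hp]; ring
  have hPW : (∑ i, W i p * transport R U W i p)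
      = -1 * (∑ i, U i p * dx i (fun q => R q ^ γ) p)
        + -ν * (∑ i, V i p * dx i (fun q => R q ^ γ) p)
        + (ε ^ 2 - ν ^ 2)
          * (∑ i, W i p * (gradStress (fun q => R q ^ m) V i p + 1 / 2 * bulkStress L V i p))
        + ν * ∑ i, W i p * (gradStress (fun q => R q ^ m) W i p + 1 / 2 * bulkStress L W i p) := by
    simp only [Finset.mul_sum, ← Finset.sum_add_distrib]
    refine Finset.sum_congr rfl fun i _ => ?_
    rw [hNW p hp, show W i p = U i p + ν * V i p by rw [hW]]
    ring
  simp only [Finset.sum_sub_distrib, mul_assoc (2 : ℝ), ← Finset.mul_sum, hPV, hPW, hsym, pow_two]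
  ring

/-- The kinetic plus potential energy density. -/
def energyDensity (γ : ℝ) (R : ℝ × Vec d → ℝ) (A W : Fin d → ℝ × Vec d → ℝ) (p : ℝ × Vec d) : ℝ :=
  (1 / 2) * R p * (∑ i, (A i p) ^ 2) + (1 / 2) * R p * (∑ i, (W i p) ^ 2) + R p ^ γ / (γ - 1)

theorem dt_energyDensity {p : ℝ × Vec d} (hΩ : IsOpen Ω) (hp : p ∈ Ω) (hR : PeriodicSmooth Ω R)
    (h0 : ∀ q ∈ Ω, 0 < R q) {W : Fin d → ℝ × Vec d → ℝ} (hVs : ∀ i, PeriodicSmooth Ω (V i))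
    (hWs : ∀ i, PeriodicSmooth Ω (W i)) (c : ℝ) :
    dt (energyDensity γ R (fun i q => c * V i q) W) p
      = 1 / 2 * c ^ 2 * (∑ i, dt (fun q => R q * V i q * V i q) p)
        + 1 / 2 * (∑ i, dt (fun q => R q * W i q * W i q) p)
        + dt (fun q => (γ - 1)⁻¹ * R q ^ γ) p := by
  have h : energyDensity γ R (fun i q => c * V i q) W
      = fun q => 1 / 2 * c ^ 2 * (∑ i, R q * V i q * V i q)
        + 1 / 2 * (∑ i, R q * W i q * W i q) + (γ - 1)⁻¹ * R q ^ γ := by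
    funext q
    simp only [energyDensity, mul_assoc (R q), ← Finset.mul_sum, mul_pow, ← pow_two]
    ring
  have h₁ : ∀ {a : Fin d → ℝ × Vec d → ℝ}, (∀ i, PeriodicSmooth Ω (a i)) →
      ∀ i, PeriodicSmooth Ω (fun q => R q * a i q * a i q) := fun ha i =>
    (hR.mul (ha i)).mul (ha i)
  have h₂ : ∀ {a : Fin d → ℝ × Vec d → ℝ}, (∀ i, PeriodicSmooth Ω (a i)) →
      PeriodicSmooth Ω (fun q => ∑ i, R q * a i q * a i q) := fun ha => .sum (h₁ ha)
  rw [h, dt_add hΩ hp (((h₂ hVs).const_mul _).add ((h₂ hWs).const_mul _))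
      ((hR.rpow_const h0 γ).const_mul _),
    dt_add hΩ hp ((h₂ hVs).const_mul _) ((h₂ hWs).const_mul _), dt_const_mul, dt_const_mul,
    dt_sum hΩ hp (h₁ hVs), dt_sum hΩ hp (h₁ hWs)]

end Energy

/-- The cylinder `[0,T] × ℝ^d`. -/
def slab (d : ℕ) (T : ℝ) : Set (ℝ × Vec d) := {p | p.1 ∈ Set.Icc 0 T}

theorem energy_equality_of_isSpatialDiv {d : ℕ} (hd : 1 ≤ d) {Ω : Set (ℝ × Vec d)}
    (hΩ : IsOpen Ω) {T : ℝ} (hS : slab d T ⊆ Ω) {e D₁ D₂ : ℝ × Vec d → ℝ} {ν : ℝ}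
    (he : PeriodicSmooth Ω e) (hD₁ : PeriodicSmooth Ω D₁) (hD₂ : PeriodicSmooth Ω D₂)
    (h : IsSpatialDiv Ω (slab d T) (fun p => dt e p + ν * D₁ p + ν * D₂ p))
    {t : ℝ} (ht : t ∈ Set.Icc 0 T) :
    (∫ x in Box d, e (t, x)) + ν * (∫ τ in (0:ℝ)..t, ∫ x in Box d, D₁ (τ, x))
      + ν * (∫ τ in (0:ℝ)..t, ∫ x in Box d, D₂ (τ, x)) = ∫ x in Box d, e (0, x) := by
  have hmem : ∀ τ ∈ Set.Icc 0 t, ∀ x : Vec d, (τ, x) ∈ Ω := fun τ hτ x =>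
    hS ⟨hτ.1, hτ.2.trans ht.2⟩
  have hint : ∀ {f : ℝ × Vec d → ℝ}, PeriodicSmooth Ω f →
      IntegrableOn f (Set.Ioc 0 t ×ˢ Box d) (volume.prod volume) := fun hf =>
    (((hf.1.continuousOn.mono fun p hp => hmem p.1 hp.1 p.2).integrableOn_compact
      (isCompact_Icc.prod isCompact_Icc)).mono_set
        (Set.prod_mono_left Set.Ioc_subset_Icc_self))
  have hprod : ∀ {f : ℝ × Vec d → ℝ}, PeriodicSmooth Ω f →
      ∫ τ in (0:ℝ)..t, ∫ x in Box d, f (τ, x)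
        = ∫ p in Set.Ioc 0 t ×ˢ Box d, f p ∂(volume.prod volume) := fun hf => by
    rw [setIntegral_prod _ (hint hf), intervalIntegral.integral_of_le ht.1]
  have hbox : ∀ τ ∈ Set.Icc 0 t, IntegrableOn (fun x => e (τ, x)) (Box d) := fun τ hτ =>
    (continuous_iff_continuousAt.2 fun x =>
      (he.differentiableAt_space hΩ (hmem τ hτ x)).continuousAt).continuousOn.integrableOn_compact
        isCompact_Icc
  have hFTC : ∫ τ in (0:ℝ)..t, ∫ x in Box d, dt e (τ, x)
      = (∫ x in Box d, e (t, x)) - ∫ x in Box d, e (0, x) := by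
    have hi : Integrable (Function.uncurry fun τ x => dt e (τ, x))
        ((volume.restrict (Set.Ioc 0 t)).prod (volume.restrict (Box d))) := by
      rw [Measure.prod_restrict]
      exact hint (he.dt hΩ)
    rw [intervalIntegral.integral_of_le ht.1, integral_integral_swap hi,
      ← integral_sub (hbox t ⟨ht.1, le_rfl⟩) (hbox 0 ⟨le_rfl, ht.1⟩)]
    refine integral_congr_ae (Filter.Eventually.of_forall fun x => ?_)
    beta_reduce
    rw [← intervalIntegral.integral_of_le ht.1]
    refine intervalIntegral.integral_eq_sub_of_hasDerivAt (f := fun τ => e (τ, x))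
      (fun τ hτ => ?_) ?_
    · rw [Set.uIcc_of_le ht.1] at hτ
      exact (he.differentiableAt_time hΩ (hmem τ hτ x)).hasDerivAt
    · refine ContinuousOn.intervalIntegrable fun τ hτ => ?_
      rw [Set.uIcc_of_le ht.1] at hτ
      exact ((he.dt hΩ).differentiableAt_time hΩ (hmem τ hτ x)).continuousAt.continuousWithinAt
  have hsum := ((he.dt hΩ).add (hD₁.const_mul ν)).add (hD₂.const_mul ν)
  have hzero : ∫ τ in (0:ℝ)..t, ∫ x in Box d, (dt e (τ, x) + ν * D₁ (τ, x) + ν * D₂ (τ, x)) = 0 := by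
    obtain ⟨F, hF, hd'⟩ := h
    refine intervalIntegral.integral_zero_ae (Filter.Eventually.of_forall fun τ hτ => ?_)
    rw [Set.uIoc_of_le ht.1] at hτ
    have hτ' : τ ∈ Set.Icc 0 t := ⟨hτ.1.le, hτ.2⟩
    rw [← integral_sum_dx_eq_zero hd hΩ hF (hmem τ hτ')]
    exact integral_congr_ae (Filter.Eventually.of_forall fun x =>
      hd' (τ, x) ⟨hτ'.1, hτ'.2.trans ht.2⟩)
  rw [hprod hsum, integral_add (hint ((he.dt hΩ).add (hD₁.const_mul ν)))
      (hint (hD₂.const_mul ν)), integral_add (hint (he.dt hΩ)) (hint (hD₁.const_mul ν)),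
    integral_const_mul, integral_const_mul, ← hprod (he.dt hΩ), ← hprod hD₁, ← hprod hD₂,
    hFTC] at hzero
  linarith

/-- Energy equality in the new variables `(ρ, v̄, w)`, `v̄ = √(ε²−ν²) v`, `w = u + νv`,
for smooth solutions of the Navier–Stokes–Korteweg system of capillarity `ε` and
viscosity `ν` on the torus:
`E^NF(t) + ν∫₀ᵗ∫ μ'(ρ)H''(ρ)|∇ρ|²
        + ν∫₀ᵗ∫ (μ(ρ)(|∇w|² + |∇v̄|²) + (λ(ρ)/2)(|div v̄|² + |div w|²)) = E^NF(0)`,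
where `E^NF(t) = ∫ (½ρ|v̄|² + ½ρ|w|² + H(ρ))`. -/
theorem nsk_new_formulation_energy_equality
    (d : ℕ) (hd1 : 1 ≤ d) (hd3 : d ≤ 3)
    (T ε ν γ s : ℝ) (hT : 0 < T) (hν : 0 < ν) (hνε : ν < ε) (hγ : 1 < γ) (hs : -1 ≤ s)
    (ρ : ℝ → Vec d → ℝ) (u v w vb : ℝ → Vec d → Vec d)
    (hρs : ContDiff ℝ (⊤ : ℕ∞) (fun p : ℝ × Vec d => ρ p.1 p.2))
    (hus : ContDiff ℝ (⊤ : ℕ∞) (fun p : ℝ × Vec d => u p.1 p.2))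
    (hρper : SpacePeriodic ρ) (huper : SpacePeriodic u)
    (hρpos : ∀ t ∈ Set.Icc 0 T, ∀ x, 0 < ρ t x)
    (μ muD lam : ℝ → ℝ)
    (hμ : ∀ z : ℝ, μ z = z ^ ((s + 3) / 2))
    (hmuD : ∀ z : ℝ, muD z = ((s + 3) / 2) * z ^ ((s + 1) / 2))
    (hlam : ∀ z : ℝ, lam z = 2 * (z * muD z - μ z))
    -- `v = ∇(μ∘ρ)/ρ`, `w = u + νv`, `v̄ = √(ε²−ν²) v`
    (hv : ∀ t ∈ Set.Icc 0 T, ∀ x i, v t x i = pd i (fun y => μ (ρ t y)) x / ρ t x)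
    (hw : ∀ t ∈ Set.Icc 0 T, ∀ x i, w t x i = u t x i + ν * v t x i)
    (hvb : ∀ t ∈ Set.Icc 0 T, ∀ x i, vb t x i = Real.sqrt (ε ^ 2 - ν ^ 2) * v t x i)
    -- mass equation `∂ₜρ + div(ρu) = 0`
    (hmass : ∀ t ∈ Set.Icc 0 T, ∀ x,
      deriv (fun τ => ρ τ x) t + (∑ i, pd i (fun y => ρ t y * u t y i) x) = 0)
    -- momentum equation `∂ₜ(ρu) + div(ρu⊗u) + ∇p(ρ) − 2ν div(μ(ρ)D(u)) − ν∇(λ(ρ)div u)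
    --   = ε²[div(μ(ρ)ᵗ∇v) + ½∇(λ(ρ)div v)]` with `D(u) = ½(∇u + ᵗ∇u)`
    (hmom : ∀ t ∈ Set.Icc 0 T, ∀ x, ∀ i,
      deriv (fun τ => ρ τ x * u τ x i) t
          + (∑ j, pd j (fun y => ρ t y * u t y i * u t y j) x)
          + pd i (fun y => ρ t y ^ γ) x
          - 2 * ν * (∑ j, pd j (fun y => μ (ρ t y)
              * ((1 / 2) * (pd j (fun z => u t z i) y + pd i (fun z => u t z j) y))) x)
          - ν * pd i (fun y => lam (ρ t y) * ∑ j, pd j (fun z => u t z j) y) x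
        = ε ^ 2 * ((∑ j, pd j (fun y => μ (ρ t y) * pd i (fun z => v t z j) y) x)
            + (1 / 2) * pd i (fun y =>
                lam (ρ t y) * ∑ j, pd j (fun z => v t z j) y) x)) :
    ∀ t ∈ Set.Icc 0 T,
      (∫ x in Box d,
          ((1 / 2) * ρ t x * (∑ i, (vb t x i) ^ 2)
            + (1 / 2) * ρ t x * (∑ i, (w t x i) ^ 2)
            + ρ t x ^ γ / (γ - 1)))
        + ν * (∫ τ in (0:ℝ)..t, ∫ x in Box d,
            muD (ρ τ x) * (γ * ρ τ x ^ (γ - 2)) * (∑ i, (pd i (fun y => ρ τ y) x) ^ 2))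
        + ν * (∫ τ in (0:ℝ)..t, ∫ x in Box d,
            (μ (ρ τ x) * ((∑ i, ∑ j, (pd j (fun y => w τ y i) x) ^ 2)
                + (∑ i, ∑ j, (pd j (fun y => vb τ y i) x) ^ 2))
              + (lam (ρ τ x) / 2) * ((∑ i, pd i (fun y => vb τ y i) x) ^ 2
                  + (∑ i, pd i (fun y => w τ y i) x) ^ 2)))
        = ∫ x in Box d,
            ((1 / 2) * ρ 0 x * (∑ i, (vb 0 x i) ^ 2)
              + (1 / 2) * ρ 0 x * (∑ i, (w 0 x i) ^ 2)
              + ρ 0 x ^ γ / (γ - 1)) := by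
  obtain ⟨R, hR⟩ : ∃ R : ℝ × Vec d → ℝ, R = fun p => ρ p.1 p.2 := ⟨_, rfl⟩
  obtain ⟨U, hU⟩ : ∃ U : Fin d → ℝ × Vec d → ℝ, U = fun i p => u p.1 p.2 i := ⟨_, rfl⟩
  obtain ⟨m, hm⟩ : ∃ m : ℝ, m = (s + 3) / 2 := ⟨_, rfl⟩
  obtain ⟨V, hV⟩ : ∃ V : Fin d → ℝ × Vec d → ℝ, V = fun i p => dx i (fun q => R q ^ m) p / R p :=
    ⟨_, rfl⟩
  obtain ⟨W, hW⟩ : ∃ W : Fin d → ℝ × Vec d → ℝ, W = fun i p => U i p + ν * V i p := ⟨_, rfl⟩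
  obtain ⟨c, hc⟩ : ∃ c : ℝ, c = Real.sqrt (ε ^ 2 - ν ^ 2) := ⟨_, rfl⟩
  have hc2 : c ^ 2 = ε ^ 2 - ν ^ 2 := by rw [hc]; exact Real.sq_sqrt (by nlinarith)
  have hm' : (s + 1) / 2 = m - 1 := by rw [hm]; ring
  rw [← hm] at hμ
  rw [← hm, hm'] at hmuD
  obtain rfl : μ = fun z => z ^ m := funext hμ
  obtain rfl : muD = fun z => m * z ^ (m - 1) := funext hmuD
  obtain rfl : lam = fun z => 2 * (z * (m * z ^ (m - 1)) - z ^ m) := funext hlam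
  beta_reduce at *
  have hρR : ∀ t x, ρ t x = R (t, x) := fun t x => by rw [hR]
  have huU : ∀ t x i, u t x i = U i (t, x) := fun t x i => by rw [hU]
  have hvV : ∀ t ∈ Set.Icc 0 T, ∀ x i, v t x i = V i (t, x) := fun t ht x i => by
    rw [hv t ht, hV, hR]; rfl
  have hwW : ∀ t ∈ Set.Icc 0 T, ∀ x i, w t x i = W i (t, x) := fun t ht x i => by
    rw [hw t ht, hW, hvV t ht, huU]
  have hvbV : ∀ t ∈ Set.Icc 0 T, ∀ x i, vb t x i = c * V i (t, x) := fun t ht x i => by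
    rw [hvb t ht, hvV t ht, hc]
  obtain ⟨Ω, hΩdef⟩ : ∃ Ω : Set (ℝ × Vec d), Ω = {p | 0 < R p} := ⟨_, rfl⟩
  have hΩ : IsOpen Ω := by
    rw [hΩdef, hR]; exact isOpen_lt continuous_const hρs.continuous
  have h0 : ∀ q ∈ Ω, 0 < R q := fun q hq => by rwa [hΩdef] at hq
  have hS : slab d T ⊆ Ω := fun p hp => by
    rw [hΩdef, hR]; exact hρpos p.1 hp p.2
  have hRs : PeriodicSmooth Ω R := by
    rw [hR]; exact ⟨hρs.contDiffOn, fun t x k => hρper t x k⟩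
  have hUs : ∀ i, PeriodicSmooth Ω (U i) := fun i => by
    rw [hU]; exact ⟨(contDiff_pi.1 hus i).contDiffOn, fun t x k => congrFun (huper t x k) i⟩
  have hMs := hRs.rpow_const h0 m
  have hVs : ∀ i, PeriodicSmooth Ω (V i) := fun i => by
    rw [hV]; exact (hMs.dx hΩ i).div hRs fun q hq => (h0 q hq).ne'
  have hWs : ∀ i, PeriodicSmooth Ω (W i) := fun i => by
    rw [hW]; exact (hUs i).add ((hVs i).const_mul ν)
  have hVbs : ∀ i, PeriodicSmooth Ω (fun q => c * V i q) := fun i => (hVs i).const_mul c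
  have hRV : ∀ i, ∀ q ∈ Ω, R q * V i q = dx i (fun q => R q ^ m) q := fun i q hq => by
    rw [hV]; exact mul_div_cancel₀ _ (h0 q hq).ne'
  obtain ⟨L, hL⟩ : ∃ L : ℝ × Vec d → ℝ,
      L = fun q => 2 * (R q * (m * R q ^ (m - 1)) - R q ^ m) := ⟨_, rfl⟩
  have hLm : ∀ q ∈ Ω, L q = 2 * (m - 1) * R q ^ m := fun q hq => by
    rw [hL]
    beta_reduce
    rw [Real.rpow_sub_one (h0 q hq).ne']
    field_simp [(h0 q hq).ne']
  have hLs : PeriodicSmooth Ω L :=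
    have h := hMs.const_mul (2 * (m - 1))
    ⟨h.1.congr hLm, fun t x k => by rw [hL]; simp only [hRs.2]⟩
  have hmass' : ∀ p ∈ slab d T, dt R p + ∑ j, dx j (fun q => R q * U j q) p = 0 := by
    intro p hp
    have h := hmass p.1 hp p.2
    simp only [hρR, huU] at h
    exact h
  have hmom' : ∀ p ∈ slab d T, ∀ i, transport R U U i p + dx i (fun q => R q ^ γ) p
      - ν * (gradStress (fun q => R q ^ m) U i p + transStress (fun q => R q ^ m) U i p)
      - ν * bulkStress L U i p
      = ε ^ 2 * (transStress (fun q => R q ^ m) V i p + 1 / 2 * bulkStress L V i p) := by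
    intro p hp i
    have h := hmom p.1 hp p.2 i
    simp only [hρR, huU, hvV p.1 hp] at h
    have h' : transport R U U i p + dx i (fun q => R q ^ γ) p
        - 2 * ν * (∑ j, dx j (fun q => R q ^ m * (1 / 2 * (dx j (U i) q + dx i (U j) q))) p)
        - ν * bulkStress L U i p
        = ε ^ 2 * (transStress (fun q => R q ^ m) V i p + 1 / 2 * bulkStress L V i p) := by
      rw [hL]; exact h
    rw [sum_dx_mul_symmGrad hΩ (hS hp) hMs hUs] at h'
    linear_combination h'
  have hbal := isSpatialDiv_energy_balance hΩ hS (fun p hp _ => hp) hRs h0 hUs hmass' hLs hLm hVs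
    hRV hγ.ne' hmom' hW
  obtain ⟨e, he⟩ : ∃ e, e = energyDensity γ R (fun i q => c * V i q) W := ⟨_, rfl⟩
  obtain ⟨D₁, hD₁⟩ : ∃ D₁ : ℝ × Vec d → ℝ, D₁ = fun p =>
    m * R p ^ (m - 1) * (γ * R p ^ (γ - 2)) * ∑ i, dx i R p ^ 2 := ⟨_, rfl⟩
  obtain ⟨D₂, hD₂⟩ : ∃ D₂ : ℝ × Vec d → ℝ, D₂ = fun p =>
    R p ^ m * ((∑ i, ∑ j, dx j (W i) p ^ 2) + ∑ i, ∑ j, dx j (fun q => c * V i q) p ^ 2)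
      + L p / 2 * ((∑ i, dx i (fun q => c * V i q) p) ^ 2 + (∑ i, dx i (W i) p) ^ 2) := ⟨_, rfl⟩
  have hsq : ∀ {f : ℝ × Vec d → ℝ}, PeriodicSmooth Ω f → PeriodicSmooth Ω (fun q => f q ^ 2) :=
    fun hf => by simpa only [pow_two] using hf.mul hf
  have hes : PeriodicSmooth Ω e := by
    rw [he]
    exact (((hRs.const_mul _).mul (.sum fun i => hsq (hVbs i))).add
      ((hRs.const_mul _).mul (.sum fun i => hsq (hWs i)))).add
      ((hRs.rpow_const h0 γ).div (.const _) fun _ _ => (sub_pos.2 hγ).ne')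
  have hD₁s : PeriodicSmooth Ω D₁ := by
    rw [hD₁]
    exact (((hRs.rpow_const h0 _).const_mul _).mul ((hRs.rpow_const h0 _).const_mul _)).mul
      (.sum fun i => hsq (hRs.dx hΩ i))
  have hD₂s : PeriodicSmooth Ω D₂ := by
    rw [hD₂]
    exact (hMs.mul ((PeriodicSmooth.sum fun i => .sum fun j => hsq ((hWs i).dx hΩ j)).add
      (.sum fun i => .sum fun j => hsq ((hVbs i).dx hΩ j)))).add
      ((hLs.div (.const 2) fun _ _ => two_ne_zero).mul
        ((hsq (.sum fun i => (hVbs i).dx hΩ i)).add (hsq (.sum fun i => (hWs i).dx hΩ i))))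
  have hdiv : IsSpatialDiv Ω (slab d T) (fun p => dt e p + ν * D₁ p + ν * D₂ p) := by
    refine hbal.congr fun p hp => ?_
    have hp' := hS hp
    have hR0 := h0 p hp'
    have h₁ : D₁ p = ∑ i, V i p * dx i (fun q => R q ^ γ) p := by
      rw [hD₁]
      beta_reduce
      rw [Finset.mul_sum]
      refine Finset.sum_congr rfl fun i _ => ?_
      have h := hRV i p hp'
      rw [dx_rpow hΩ hp' hRs h0] at h ⊢
      have hγ2 : R p ^ (γ - 1) = R p ^ (γ - 2) * R p := by
        rw [show γ - 2 = γ - 1 - 1 by ring, Real.rpow_sub_one hR0.ne' (γ - 1)]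
        field_simp
      rw [hγ2]
      linear_combination (-(γ * R p ^ (γ - 2) * dx i R p)) * h
    have h₂ : ∀ i j, dx j (fun q => c * V i q) p = c * dx j (V i) p := fun i j =>
      dx_const_mul hΩ hp' (hVs i) c j
    rw [he, dt_energyDensity hΩ hp' hRs h0 hVs hWs, h₁, hD₂]
    simp only [h₂, mul_pow, ← Finset.mul_sum, hc2, spaceDiv]
  intro t ht
  have key := energy_equality_of_isSpatialDiv hd1 hΩ hS hes hD₁s hD₂s hdiv ht
  have hE : ∀ τ ∈ Set.Icc 0 T, ∀ x, (1 / 2) * ρ τ x * (∑ i, (vb τ x i) ^ 2)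
      + (1 / 2) * ρ τ x * (∑ i, (w τ x i) ^ 2) + ρ τ x ^ γ / (γ - 1) = e (τ, x) :=
    fun τ hτ x => by
      simp only [he, energyDensity, hρR, hvbV τ hτ, hwW τ hτ]
  have hsub : ∀ τ ∈ Set.uIcc 0 t, τ ∈ Set.Icc 0 T := fun τ hτ => by
    rw [Set.uIcc_of_le ht.1] at hτ
    exact ⟨hτ.1, hτ.2.trans ht.2⟩
  simp only [hE t ht, hE 0 ⟨le_rfl, hT.le⟩]
  rw [← key]
  congr 2
  · congr 1
    refine intervalIntegral.integral_congr fun τ _ => ?_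
    simp only [hρR, hD₁]
    rfl
  · refine intervalIntegral.integral_congr fun τ hτ => ?_
    simp only [hρR, hwW τ (hsub τ hτ), hvbV τ (hsub τ hτ), hD₂, hL]
    rfl
end
end

section
/- For all reals ρ > 0, r > 0 and every t with 0 ≤ t ≤ 1, one has ( (ρ/r)^{t/2} − (ρ/r)^{1/2} )² ≤ (2/r^t) |ρ^t − r^t| + (2/r) |ρ − r|. -/
noncomputable section

theorem sq_sub_one_le_abs_sq_sub_one {a : ℝ} (ha : 0 ≤ a) : (a - 1) ^ 2 ≤ |a ^ 2 - 1| := by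
  rcases le_total 1 a with h | h
  · exact le_trans (by nlinarith) (le_abs_self _)
  · exact le_trans (by nlinarith) (neg_le_abs _)

theorem sq_rpow_half {x : ℝ} (hx : 0 ≤ x) (s : ℝ) : (x ^ (s / 2)) ^ 2 = x ^ s := by
  rw [← Real.rpow_mul_natCast hx]
  norm_num

theorem two_mul_abs_div_sub_one {p q : ℝ} (hq : 0 < q) :
    2 * |p / q - 1| = 2 / q * |p - q| := by
  rw [div_sub_one hq.ne', abs_div, abs_of_pos hq]
  ring

/-- Key estimate (with `t = −s` for `K(ρ) = ρ^s`, `−1 ≤ s ≤ 0`) showing that the augmented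
relative entropy controls the Giesselmann–Lattanzio–Tzavaras one:
`((ρ/r)^(t/2) − (ρ/r)^(1/2))² ≤ (2/r^t)|ρ^t − r^t| + (2/r)|ρ − r|`. -/
theorem key_power_estimate (ρ r t : ℝ) (hρ : 0 < ρ) (hr : 0 < r)
    (ht0 : 0 ≤ t) (ht1 : t ≤ 1) :
    ((ρ / r) ^ (t / 2) - (ρ / r) ^ ((1 : ℝ) / 2)) ^ 2
      ≤ (2 / r ^ t) * |ρ ^ t - r ^ t| + (2 / r) * |ρ - r| := by
  have hx : 0 ≤ ρ / r := (div_pos hρ hr).le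
  have h₁ := sq_sub_one_le_abs_sq_sub_one (Real.rpow_nonneg hx (t / 2))
  have h₂ := sq_sub_one_le_abs_sq_sub_one (Real.rpow_nonneg hx ((1 : ℝ) / 2))
  rw [sq_rpow_half hx, Real.div_rpow hρ.le hr.le t] at h₁
  rw [sq_rpow_half hx, Real.rpow_one] at h₂
  rw [← two_mul_abs_div_sub_one (Real.rpow_pos_of_pos hr t), ← two_mul_abs_div_sub_one hr]
  nlinarith [sq_nonneg ((ρ / r) ^ (t / 2) - 1 + ((ρ / r) ^ ((1 : ℝ) / 2) - 1))]
end
end
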